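/- arXiv:0802.0015 — 2 statements merged into one kernel-verified Lean document; each statement's English description precedes it below -/
import Mathlib

section
/- Let q = 2^t for a positive integer t. Suppose h ∈ k[x0,x1,x2] is a polynomial in which every indeterminate has degree at most q-1, and suppose the class (1 + x3^{q-1})·h + I lies in the k-span of the classes of the line polynomials (1 + α^{q-1})(1 + β^{q-1}) + I over all lines ℓ ∈ L (α, β linear forms whose common zero set is ℓ). Then h lies in the k-span of the constant polynomial 1 together with the q monomials ∏_{i=0}^{t-1} g_i^{2^i} with each g_i ∈ {x1, x2}; in particular h does not involve the indeterminate x0. -/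
open Submodule Module MvPolynomial
open scoped Classical

noncomputable section

variable (k : Type) [Field k] [Fintype k]

/-- The nonsingular alternating bilinear form on `k^4`. -/
def B (u v : Fin 4 → k) : k := u 0 * v 3 - u 3 * v 0 + u 1 * v 2 - u 2 * v 1

/-- Lines: totally isotropic 2-dimensional subspaces of `k^4`. -/
def IsLn (l : Submodule k (Fin 4 → k)) : Prop :=
  finrank k l = 2 ∧ ∀ u ∈ l, ∀ v ∈ l, B k u v = 0

/-- The ideal `I = (x0^q - x0, x1^q - x1, x2^q - x2, x3^q - x3)` of `R = k[x0,x1,x2,x3]`. -/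
def II (q : ℕ) : Ideal (MvPolynomial (Fin 4) k) :=
  Ideal.span (Set.range fun i : Fin 4 => X i ^ q - X i)

/-- The linear form `a0*x0 + a1*x1 + a2*x2 + a3*x3`. -/
def linForm (a : Fin 4 → k) : MvPolynomial (Fin 4) k := ∑ i : Fin 4, C (a i) * X i

/-- The polynomials `(1 + α^{q-1})(1 + β^{q-1})` for pairs of linear forms `α, β`
whose common zero set in `V` is exactly a line `ℓ ∈ L`. -/
def linePolys (q : ℕ) : Set (MvPolynomial (Fin 4) k) :=
  {c | ∃ (l : Submodule k (Fin 4 → k)) (a b : Fin 4 → k), IsLn k l ∧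
    {v : Fin 4 → k | eval v (linForm k a) = 0 ∧ eval v (linForm k b) = 0}
      = (l : Set (Fin 4 → k)) ∧
    c = (1 + linForm k a ^ (q - 1)) * (1 + linForm k b ^ (q - 1))}

/-- The allowed digits. -/
def digitSet : Set (MvPolynomial (Fin 4) k) :=
  {1, X 0, X 1, X 2, X 3, X 0 * X 1, X 0 * X 2, X 1 * X 3, X 2 * X 3, X 0 * X 3 + X 1 * X 2}

/-- The set `β` of products `∏ f_i^{2^i}` with every digit `f_i` in `digitSet`. -/
def betaSet (t : ℕ) : Set (MvPolynomial (Fin 4) k) :=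
  {g | ∃ f : Fin t → MvPolynomial (Fin 4) k,
    (∀ i, f i ∈ digitSet k) ∧ g = ∏ i : Fin t, f i ^ 2 ^ (i : ℕ)}

section Reduction

variable {σ : Type*} {F : Type*} [Field F]

/-- The exponent of the reduced power representing `x ^ n` modulo `x ^ q - x`. -/
def redExp (q n : ℕ) : ℕ := if n = 0 then 0 else (n - 1) % (q - 1) + 1

lemma redExp_zero (q : ℕ) : redExp q 0 = 0 := rfl

lemma redExp_le (q n : ℕ) : redExp q n ≤ n := by
  unfold redExp
  split_ifs with h
  · omega
  · have := Nat.mod_le (n - 1) (q - 1)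
    omega

lemma redExp_eq_self {q n : ℕ} (h : n ≤ q - 1) : redExp q n = n := by
  unfold redExp
  split_ifs with h0
  · exact h0.symm
  · rw [Nat.mod_eq_of_lt (by omega)]
    omega

lemma redExp_modEq (q n : ℕ) : redExp q n ≡ n [MOD q - 1] := by
  unfold redExp
  split_ifs with h0
  · rw [h0]
  · have h := (Nat.mod_modEq (n - 1) (q - 1)).add_right 1
    rwa [Nat.sub_add_cancel (by omega)] at h

lemma redExp_add_card {q : ℕ} (hq : 2 ≤ q) (n : ℕ) : redExp q (n + q) = redExp q (n + 1) := by
  unfold redExp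
  rw [if_neg (by omega), if_neg (by omega), show n + q - 1 = n + (q - 1) by omega,
    Nat.add_mod_right, Nat.add_sub_cancel]

/-- Componentwise reduction of an exponent vector. -/
def redMon (q : ℕ) (m : σ →₀ ℕ) : σ →₀ ℕ := m.mapRange (redExp q) (redExp_zero q)

lemma redMon_apply (q : ℕ) (m : σ →₀ ℕ) (i : σ) : redMon q m i = redExp q (m i) :=
  Finsupp.mapRange_apply ..

lemma redMon_eq_self {q : ℕ} {m : σ →₀ ℕ} (h : ∀ i, m i ≤ q - 1) : redMon q m = m := by
  ext i
  rw [redMon_apply, redExp_eq_self (h i)]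

lemma redMon_add_card {q : ℕ} (hq : 2 ≤ q) (m : σ →₀ ℕ) (i : σ) :
    redMon q (m + Finsupp.single i q) = redMon q (m + Finsupp.single i 1) := by
  ext j
  simp only [redMon_apply, Finsupp.add_apply]
  rcases eq_or_ne i j with rfl | hij
  · simpa using redExp_add_card hq (m i)
  · simp [Finsupp.single_eq_of_ne' hij]

lemma redMon_degree_le [Fintype σ] (q : ℕ) (m : σ →₀ ℕ) : (redMon q m).degree ≤ m.degree := by
  simp only [Finsupp.degree_eq_sum, redMon_apply]
  exact Finset.sum_le_sum fun i _ => redExp_le q (m i)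

lemma redMon_degree_modEq [Fintype σ] (q : ℕ) (m : σ →₀ ℕ) :
    (redMon q m).degree ≡ m.degree [MOD q - 1] := by
  simp only [Finsupp.degree_eq_sum, redMon_apply]
  exact Nat.ModEq.sum fun i _ => redExp_modEq q (m i)

lemma eq_of_redMon_degree [Fintype σ] {q : ℕ} {m : σ →₀ ℕ}
    (h : m.degree ≤ (redMon q m).degree) : redMon q m = m := by
  ext i
  simp only [Finsupp.degree_eq_sum, redMon_apply] at h ⊢
  by_contra hne
  exact absurd h (not_le.mpr (Finset.sum_lt_sum (fun i _ => redExp_le q (m i))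
    ⟨i, Finset.mem_univ i, lt_of_le_of_ne (redExp_le q (m i)) hne⟩))

/-- The linear map reducing every exponent of a polynomial modulo `x ^ q - x`. -/
def reduce (F : Type*) [Field F] (q : ℕ) : MvPolynomial σ F →ₗ[F] MvPolynomial σ F :=
  (basisMonomials σ F).constr F fun m => monomial (redMon q m) 1

lemma reduce_monomial (q : ℕ) (m : σ →₀ ℕ) (c : F) :
    reduce F q (monomial m c) = monomial (redMon q m) c := by
  have h : monomial m c = c • basisMonomials σ F m := by simp [smul_monomial]
  rw [h, map_smul, reduce, Basis.constr_basis, smul_monomial, smul_eq_mul, mul_one]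

lemma coeff_reduce (q : ℕ) (p : MvPolynomial σ F) (e : σ →₀ ℕ) :
    coeff e (reduce F q p) = ∑ m ∈ p.support, if redMon q m = e then coeff m p else 0 := by
  conv_lhs => rw [p.as_sum]
  simp only [map_sum, reduce_monomial, coeff_sum, coeff_monomial]

lemma exists_of_coeff_reduce_ne_zero {q : ℕ} {p : MvPolynomial σ F} {e : σ →₀ ℕ}
    (h : coeff e (reduce F q p) ≠ 0) : ∃ m, coeff m p ≠ 0 ∧ redMon q m = e := by
  rw [coeff_reduce] at h
  obtain ⟨m, hm, hne⟩ := Finset.exists_ne_zero_of_sum_ne_zero h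
  exact ⟨m, mem_support_iff.mp hm, by by_contra hc; exact hne (if_neg hc)⟩

lemma reduce_eq_self {q : ℕ} {p : MvPolynomial σ F}
    (h : ∀ m, coeff m p ≠ 0 → ∀ i, m i ≤ q - 1) : reduce F q p = p := by
  conv_lhs => rw [p.as_sum]
  conv_rhs => rw [p.as_sum]
  rw [map_sum]
  refine Finset.sum_congr rfl fun m hm => ?_
  rw [reduce_monomial, redMon_eq_self (h m (mem_support_iff.mp hm))]

/-- Top-degree coefficients are not affected by reduction. -/
lemma coeff_reduce_of_degree_le [Fintype σ] {q : ℕ} {p : MvPolynomial σ F} {e : σ →₀ ℕ}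
    (he : ∀ i, e i ≤ q - 1) (hp : ∀ m, coeff m p ≠ 0 → m.degree ≤ e.degree) :
    coeff e (reduce F q p) = coeff e p := by
  rw [coeff_reduce, Finset.sum_eq_single e]
  · rw [if_pos (redMon_eq_self he)]
  · intro m hm hne
    refine if_neg fun hme => hne ?_
    rw [← hme]
    refine (eq_of_redMon_degree ?_).symm
    rw [hme]
    exact hp m (mem_support_iff.mp hm)
  · intro h
    rw [if_pos (redMon_eq_self he)]
    exact notMem_support_iff.mp h

lemma reduce_mul_eq_zero {q : ℕ} (hq : 2 ≤ q) (p : MvPolynomial σ F) (i : σ) :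
    reduce F q (p * (X i ^ q - X i)) = 0 := by
  induction p using MvPolynomial.induction_on' with
  | monomial m c =>
    have h1 : (X i : MvPolynomial σ F) = monomial (Finsupp.single i 1) 1 := rfl
    rw [mul_sub, X_pow_eq_monomial, h1, monomial_mul, monomial_mul, map_sub, reduce_monomial,
      reduce_monomial, redMon_add_card hq, sub_self]
  | add p r hp hr => rw [add_mul, map_add, hp, hr, add_zero]

end Reduction

section Digits

variable {σ : Type*}

/-- The exponent vector with binary digits `d`. -/
def ofDigitVec {t : ℕ} (d : Fin t → σ →₀ ℕ) : σ →₀ ℕ := ∑ i : Fin t, 2 ^ (i : ℕ) • d i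

lemma ofDigitVec_succ {t : ℕ} (d : Fin (t + 1) → σ →₀ ℕ) :
    ofDigitVec d = d 0 + 2 • ofDigitVec fun i => d i.succ := by
  simp only [ofDigitVec, Fin.sum_univ_succ, Finset.smul_sum, Fin.val_succ, pow_succ', mul_smul,
    Fin.val_zero, pow_zero, one_smul]

lemma sum_two_pow (t : ℕ) : ∑ i : Fin t, 2 ^ (i : ℕ) = 2 ^ t - 1 := by
  rw [Fin.sum_univ_eq_sum_range (fun i => 2 ^ i) t, Nat.geomSum_eq le_rfl]
  simp

lemma ofDigitVec_apply {t : ℕ} (d : Fin t → σ →₀ ℕ) (j : σ) :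
    ofDigitVec d j = ∑ i : Fin t, 2 ^ (i : ℕ) * d i j := by
  simp [ofDigitVec, Finsupp.finsetSum_apply]

lemma ofDigitVec_apply_le {t : ℕ} {d : Fin t → σ →₀ ℕ} (hd : ∀ i j, d i j ≤ 1) (j : σ) :
    ofDigitVec d j ≤ 2 ^ t - 1 := by
  rw [ofDigitVec_apply, ← sum_two_pow]
  exact Finset.sum_le_sum fun i _ => by simpa using Nat.mul_le_mul_left (2 ^ (i : ℕ)) (hd i j)

lemma ofDigitVec_apply_lt {t : ℕ} {d : Fin t → σ →₀ ℕ} (hd : ∀ i j, d i j ≤ 1) {j : σ} {i : Fin t}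
    (hi : d i j = 0) : ofDigitVec d j < 2 ^ t - 1 := by
  rw [ofDigitVec_apply, ← sum_two_pow]
  exact Finset.sum_lt_sum
    (fun i _ => by simpa using Nat.mul_le_mul_left (2 ^ (i : ℕ)) (hd i j))
    ⟨i, Finset.mem_univ i, by simp [hi]⟩

lemma ofDigitVec_degree {t : ℕ} {d : Fin t → σ →₀ ℕ} (hd : ∀ i, (d i).degree = 2) :
    (ofDigitVec d).degree = 2 * (2 ^ t - 1) := by
  rw [ofDigitVec, map_sum, ← sum_two_pow, Finset.mul_sum]
  refine Finset.sum_congr rfl fun i _ => ?_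
  rw [map_nsmul, hd, smul_eq_mul, mul_comm]

lemma ofDigitVec_const_add {t : ℕ} (u : σ →₀ ℕ) (d : Fin t → σ →₀ ℕ) :
    (ofDigitVec fun i => u + d i) = (2 ^ t - 1) • u + ofDigitVec d := by
  simp only [ofDigitVec, smul_add, Finset.sum_add_distrib, ← Finset.sum_smul, sum_two_pow]

lemma monomial_ofDigitVec_single {F : Type*} [Field F] {t : ℕ} (g : Fin t → σ) :
    monomial (ofDigitVec fun i => Finsupp.single (g i) 1) (1 : F) =
      ∏ i : Fin t, X (g i) ^ 2 ^ (i : ℕ) := by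
  simp only [ofDigitVec, monomial_sum_one, X_pow_eq_monomial, Finsupp.smul_single, smul_eq_mul,
    mul_one]

end Digits

section Coefficients

variable {σ : Type*} {F : Type*} [Field F] [CharP F 2]

lemma sq_eq_sum_monomial (P : MvPolynomial σ F) :
    P ^ 2 = ∑ m ∈ P.support, monomial (2 • m) (coeff m P ^ 2) := by
  conv_lhs => rw [P.as_sum]
  rw [sum_pow_char 2]
  simp only [monomial_pow]

lemma exists_of_coeff_sq_ne_zero {P : MvPolynomial σ F} {e : σ →₀ ℕ}
    (h : coeff e (P ^ 2) ≠ 0) : ∃ m, e = 2 • m ∧ coeff m P ≠ 0 := by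
  rw [sq_eq_sum_monomial, coeff_sum] at h
  obtain ⟨m, hm, hne⟩ := Finset.exists_ne_zero_of_sum_ne_zero h
  rw [coeff_monomial] at hne
  refine ⟨m, ?_, mem_support_iff.mp hm⟩
  by_contra hc
  exact hne (if_neg (Ne.symm hc))

lemma coeff_two_smul_sq (P : MvPolynomial σ F) (m : σ →₀ ℕ) :
    coeff (2 • m) (P ^ 2) = coeff m P ^ 2 := by
  rw [sq_eq_sum_monomial, coeff_sum, Finset.sum_eq_single m]
  · rw [coeff_monomial, if_pos rfl]
  · intro n _ hne
    rw [coeff_monomial, if_neg]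
    intro h
    apply hne
    ext i
    have := DFunLike.congr_fun h i
    simp only [Finsupp.smul_apply, smul_eq_mul] at this
    omega
  · intro h
    rw [notMem_support_iff.mp h]
    simp

/-- In a product of a quadratic form and a square, a monomial whose lowest binary digit is
square-free of degree two arises in only one way. -/
lemma coeff_mul_sq [Fintype σ] {Q P : MvPolynomial σ F} (hQ : Q.IsHomogeneous 2)
    {d : σ →₀ ℕ} (hd : ∀ i, d i ≤ 1) (hd2 : d.degree = 2) (m : σ →₀ ℕ) :
    coeff (d + 2 • m) (Q * P ^ 2) = coeff d Q * coeff m P ^ 2 := by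
  rw [coeff_mul, Finset.sum_eq_single (d, 2 • m)]
  · rw [coeff_two_smul_sq]
  · rintro ⟨u, v⟩ huv hne
    rw [Finset.HasAntidiagonal.mem_antidiagonal] at huv
    by_contra hc
    obtain ⟨hu, hv⟩ := ne_zero_and_ne_zero_of_mul hc
    obtain ⟨n, rfl, -⟩ := exists_of_coeff_sq_ne_zero hv
    have hu2 : u.degree = 2 := by
      by_contra hc
      exact hu (hQ.coeff_eq_zero hc)
    have hle : ∀ i, d i ≤ u i := by
      intro i
      have := DFunLike.congr_fun huv i
      have := hd i
      simp only [Finsupp.add_apply, Finsupp.smul_apply, smul_eq_mul] at *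
      omega
    have hdu : d = u := by
      ext i
      by_contra hne
      have : d.degree < u.degree := by
        simp only [Finsupp.degree_eq_sum]
        exact Finset.sum_lt_sum (fun i _ => hle i)
          ⟨i, Finset.mem_univ i, lt_of_le_of_ne (hle i) hne⟩
      omega
    subst hdu
    exact hne (Prod.ext rfl (add_left_cancel huv))
  · intro h
    rw [Finset.HasAntidiagonal.mem_antidiagonal] at h
    exact absurd rfl h

lemma pow_two_pow_succ_sub_one {M : Type*} [Monoid M] (Q : M) (t : ℕ) :
    Q ^ (2 ^ (t + 1) - 1) = Q * (Q ^ (2 ^ t - 1)) ^ 2 := by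
  rw [← pow_mul, ← pow_succ']
  congr 1
  have := Nat.one_le_two_pow (n := t)
  omega

lemma coeff_ofDigitVec [Fintype σ] {Q : MvPolynomial σ F} (hQ : Q.IsHomogeneous 2) {t : ℕ}
    (d : Fin t → σ →₀ ℕ) (hd : ∀ i j, d i j ≤ 1) (hd2 : ∀ i, (d i).degree = 2) :
    coeff (ofDigitVec d) (Q ^ (2 ^ t - 1)) = ∏ i, coeff (d i) Q ^ 2 ^ (i : ℕ) := by
  induction t with
  | zero => simp [ofDigitVec]
  | succ t ih =>
    rw [ofDigitVec_succ, pow_two_pow_succ_sub_one, coeff_mul_sq hQ (hd 0) (hd2 0),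
      ih _ (fun i => hd i.succ) (fun i => hd2 i.succ), Fin.prod_univ_succ, ← Finset.prod_pow]
    simp [pow_succ, pow_mul]

/-- A monomial of `Q ^ (2 ^ t - 1)` with full exponent in `x j` has all its digits of the form
`x j * x i` with `i ≠ j`. -/
lemma exists_digits_of_coeff_ne_zero [Fintype σ] {Q : MvPolynomial σ F} (hQ : Q.IsHomogeneous 2)
    {j : σ} {t : ℕ} {e : σ →₀ ℕ} (hej : e j = 2 ^ t - 1)
    (he : coeff e (Q ^ (2 ^ t - 1)) ≠ 0) :
    ∃ g : Fin t → σ, (∀ i, g i ≠ j) ∧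
      e = ofDigitVec fun i => Finsupp.single j 1 + Finsupp.single (g i) 1 := by
  induction t generalizing e with
  | zero =>
    refine ⟨Fin.elim0, fun i => i.elim0, ?_⟩
    by_contra hc
    apply he
    simp only [pow_zero, Nat.sub_self, coeff_one]
    rw [if_neg]
    intro h
    exact hc (by simp [ofDigitVec, ← h])
  | succ t ih =>
    rw [pow_two_pow_succ_sub_one, coeff_mul] at he
    obtain ⟨⟨u, v⟩, huv, hne⟩ := Finset.exists_ne_zero_of_sum_ne_zero he
    rw [Finset.HasAntidiagonal.mem_antidiagonal] at huv
    obtain ⟨hu, hv⟩ := ne_zero_and_ne_zero_of_mul hne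
    obtain ⟨n, rfl, hn⟩ := exists_of_coeff_sq_ne_zero hv
    have hu2 : u.degree = 2 := by
      by_contra hc
      exact hu (hQ.coeff_eq_zero hc)
    have huj : u j ≤ 2 := hu2 ▸ Finsupp.le_degree j u
    have hj := DFunLike.congr_fun huv j
    simp only [Finsupp.add_apply, Finsupp.smul_apply, smul_eq_mul, hej, pow_succ] at hj
    have hpos := Nat.one_le_two_pow (n := t)
    have huj1 : u j = 1 := by omega
    obtain ⟨g, hg, rfl⟩ := ih (e := n) (by omega) hn
    obtain ⟨w, hw⟩ : ∃ w, u = Finsupp.single j 1 + w :=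
      ⟨u - Finsupp.single j 1, (add_tsub_cancel_of_le (by simp [huj1])).symm⟩
    have hwj : w j = 0 := by
      have := DFunLike.congr_fun hw j
      simp at this
      omega
    have hw1 : w.degree = 1 := by
      rw [hw, map_add, Finsupp.degree_single] at hu2
      omega
    obtain ⟨i, rfl⟩ : ∃ i, w = Finsupp.single i 1 := by
      have hw0 : w ≠ 0 := by
        rintro rfl
        simp at hw1
      obtain ⟨i, hi⟩ := Finsupp.ne_iff.mp hw0
      have hle : Finsupp.single i 1 ≤ w := by
        rw [Finsupp.single_le_iff]
        exact Nat.one_le_iff_ne_zero.mpr hi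
      refine ⟨i, ?_⟩
      have hsum := add_tsub_cancel_of_le hle
      have hdeg := congrArg Finsupp.degree hsum
      rw [map_add, Finsupp.degree_single, hw1] at hdeg
      have hz := (Finsupp.degree_eq_zero_iff _).mp (by omega :
        (w - Finsupp.single i 1).degree = 0)
      rw [← hsum, hz, add_zero]
    refine ⟨Fin.cons i g, ?_, ?_⟩
    · intro l
      refine Fin.cases ?_ hg l
      rintro rfl
      simp at hwj
    · rw [ofDigitVec_succ, ← huv, hw]
      simp

end Coefficients

section Lines

variable {F : Type} [Field F]

lemma linForm_isHomogeneous (a : Fin 4 → F) : (linForm F a).IsHomogeneous 1 :=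
  IsHomogeneous.sum _ _ _ fun i _ => isHomogeneous_C_mul_X (a i) i

lemma eval_linForm (a v : Fin 4 → F) : eval v (linForm F a) = ∑ i, a i * v i := by
  simp [linForm]

lemma linForm_mul_isHomogeneous (a b : Fin 4 → F) :
    (linForm F a * linForm F b).IsHomogeneous 2 :=
  (linForm_isHomogeneous a).mul (linForm_isHomogeneous b)

lemma coeff_linForm_mul (a b : Fin 4 → F) {i j : Fin 4} (hij : i ≠ j) :
    coeff (Finsupp.single i 1 + Finsupp.single j 1) (linForm F a * linForm F b) =
      a i * b j + a j * b i := by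
  have hc (l : Fin 4) : coeff (Finsupp.single l 1) (linForm F a) = a l := by
    simp [linForm, coeff_sum, coeff_C_mul, coeff_X, Finsupp.single_left_inj]
  have hterm (l : Fin 4) (p : MvPolynomial (Fin 4) F) :
      p * (C (b l) * X l) = C (b l) * (p * X l) := by
    ring
  rw [show linForm F b = ∑ l, C (b l) * X l from rfl, Finset.mul_sum, coeff_sum]
  simp only [hterm, coeff_C_mul]
  rw [Fintype.sum_eq_add i j hij]
  · rw [coeff_mul_X, add_comm (Finsupp.single i 1), coeff_mul_X, hc, hc]
    ring
  · rintro l ⟨hli, hlj⟩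
    rw [coeff_mul_X', if_neg, mul_zero]
    simp [Finsupp.single_eq_of_ne hli, Finsupp.single_eq_of_ne hlj]

/-- For a totally isotropic line cut out by two linear forms, two Plücker coordinates agree. -/
lemma plucker_eq [CharP F 2] {l : Submodule F (Fin 4 → F)} {a b : Fin 4 → F}
    (hl : ∀ u ∈ l, ∀ v ∈ l, B F u v = 0)
    (hab : {v : Fin 4 → F | eval v (linForm F a) = 0 ∧ eval v (linForm F b) = 0} =
      (l : Set (Fin 4 → F))) :
    a 0 * b 3 + a 3 * b 0 = a 1 * b 2 + a 2 * b 1 := by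
  have h2 : (2 : F) = 0 := CharTwo.two_eq_zero
  have hmem : ∀ v : Fin 4 → F, ∑ i, a i * v i = 0 → ∑ i, b i * v i = 0 → v ∈ l := by
    intro v hv hv'
    rw [← SetLike.mem_coe, ← hab]
    exact ⟨(eval_linForm a v).trans hv, (eval_linForm b v).trans hv'⟩
  set p : Fin 4 → Fin 4 → F := fun i j => a i * b j - a j * b i with hp
  have h012 : ![p 1 2, -p 0 2, p 0 1, 0] ∈ l := by
    apply hmem <;> simp [Fin.sum_univ_four, hp] <;> ring
  have h013 : ![p 1 3, -p 0 3, 0, p 0 1] ∈ l := by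
    apply hmem <;> simp [Fin.sum_univ_four, hp] <;> ring
  have h023 : ![p 2 3, 0, -p 0 3, p 0 2] ∈ l := by
    apply hmem <;> simp [Fin.sum_univ_four, hp] <;> ring
  have h123 : ![0, p 2 3, -p 1 3, p 1 2] ∈ l := by
    apply hmem <;> simp [Fin.sum_univ_four, hp] <;> ring
  have e1 := hl _ h013 _ h023
  have e2 := hl _ h012 _ h123
  simp [B, hp] at e1 e2
  have hsq : ((a 0 * b 3 + a 3 * b 0) - (a 1 * b 2 + a 2 * b 1)) ^ 2 = 0 := by
    linear_combination e1 + e2 + 2 * (a 0 * b 3 * a 3 * b 0 - a 0 * b 3 * a 1 * b 2 -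
      a 3 * b 0 * a 2 * b 1 + a 1 * b 2 * a 2 * b 1) * h2
  exact sub_eq_zero.mp (pow_eq_zero_iff two_ne_zero |>.mp hsq)

/-- The nonzero homogeneous components of a line polynomial have degree `0`, `n` or `2 * n`. -/
lemma degree_of_coeff_line_ne_zero {n : ℕ} {a b : Fin 4 → F} {m : Fin 4 →₀ ℕ}
    (h : coeff m ((1 + linForm F a ^ n) * (1 + linForm F b ^ n)) ≠ 0) :
    m.degree = 0 ∨ m.degree = n ∨ m.degree = 2 * n := by
  have ha := (linForm_isHomogeneous a).pow n
  have hb := (linForm_isHomogeneous b).pow n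
  have hc := (linForm_mul_isHomogeneous a b).pow n
  rw [one_mul] at ha hb
  contrapose! h
  have hexp : (1 + linForm F a ^ n) * (1 + linForm F b ^ n) =
      1 + linForm F a ^ n + linForm F b ^ n + (linForm F a * linForm F b) ^ n := by ring
  rw [hexp, coeff_add, coeff_add, coeff_add, (isHomogeneous_one (Fin 4) F).coeff_eq_zero h.1,
    ha.coeff_eq_zero h.2.1, hb.coeff_eq_zero h.2.1, hc.coeff_eq_zero h.2.2]
  simp

lemma coeff_line_top {n : ℕ} (hn : 0 < n) {a b : Fin 4 → F} {m : Fin 4 →₀ ℕ}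
    (hm : m.degree = 2 * n) :
    coeff m ((1 + linForm F a ^ n) * (1 + linForm F b ^ n)) =
      coeff m ((linForm F a * linForm F b) ^ n) := by
  have ha := (linForm_isHomogeneous a).pow n
  have hb := (linForm_isHomogeneous b).pow n
  rw [one_mul] at ha hb
  have hexp : (1 + linForm F a ^ n) * (1 + linForm F b ^ n) =
      1 + linForm F a ^ n + linForm F b ^ n + (linForm F a * linForm F b) ^ n := by ring
  rw [hexp, coeff_add, coeff_add, coeff_add,
    (isHomogeneous_one (Fin 4) F).coeff_eq_zero (by omega), ha.coeff_eq_zero (by omega),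
    hb.coeff_eq_zero (by omega)]
  simp

end Lines

section Code

variable {F : Type} [Field F]

lemma reduce_eq_zero_of_mem_II {q : ℕ} (hq : 2 ≤ q) {p : MvPolynomial (Fin 4) F} (hp : p ∈ II F q) :
    reduce F q p = 0 := by
  suffices h : ∀ r, reduce F q (r * p) = 0 by simpa using h 1
  induction hp using Submodule.span_induction with
  | mem x hx =>
    obtain ⟨i, rfl⟩ := hx
    exact fun r => reduce_mul_eq_zero hq r i
  | zero => simp
  | add x y _ _ hx hy => exact fun r => by rw [mul_add, map_add, hx, hy, add_zero]
  | smul s x _ ih => exact fun r => by rw [smul_eq_mul, ← mul_assoc, ih]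

/-- A linear functional of the reduced form that vanishes on all line polynomials vanishes on
every polynomial whose class is in the span of their classes. -/
lemma functional_eq_zero_of_mem_span {q : ℕ} (hq : 2 ≤ q) {f : MvPolynomial (Fin 4) F}
    (hf : Ideal.Quotient.mk (II F q) f ∈
      span F (Ideal.Quotient.mk (II F q) '' linePolys F q))
    (φ : MvPolynomial (Fin 4) F →ₗ[F] F)
    (hφ : ∀ c ∈ linePolys F q, φ (reduce F q c) = 0) : φ (reduce F q f) = 0 := by
  have himg : (Ideal.Quotient.mk (II F q) '' linePolys F q) =
      (Ideal.Quotient.mkₐ F (II F q)).toLinearMap '' linePolys F q := rfl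
  rw [himg, ← Submodule.map_span] at hf
  obtain ⟨c, hc, hcf⟩ := hf
  have hsub : c - f ∈ II F q := Ideal.Quotient.eq.mp hcf
  have h0 := reduce_eq_zero_of_mem_II hq hsub
  rw [map_sub, sub_eq_zero] at h0
  rw [← h0]
  have hle : span F (linePolys F q) ≤ LinearMap.ker (φ ∘ₗ reduce F q) :=
    Submodule.span_le.mpr hφ
  exact hle hc

/-- A nonzero coefficient of a reduced polynomial in the line code sits in degree `0`, `q - 1` or
`2 * (q - 1)`, up to reduction. -/
lemma degree_of_coeff_ne_zero {q : ℕ} (hq : 2 ≤ q) {f : MvPolynomial (Fin 4) F}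
    (hf : Ideal.Quotient.mk (II F q) f ∈
      span F (Ideal.Quotient.mk (II F q) '' linePolys F q))
    {e : Fin 4 →₀ ℕ} (he : coeff e (reduce F q f) ≠ 0) :
    e.degree ≤ 2 * (q - 1) ∧ q - 1 ∣ e.degree := by
  by_contra hcon
  refine he (functional_eq_zero_of_mem_span hq hf (lcoeff F e) ?_)
  rintro c ⟨l, a, b, -, -, rfl⟩
  by_contra hne
  obtain ⟨m, hm, rfl⟩ := exists_of_coeff_reduce_ne_zero hne
  have hle := redMon_degree_le q m
  have hmod := redMon_degree_modEq q m
  have hdeg := degree_of_coeff_line_ne_zero hm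
  refine hcon ⟨by omega, (hmod.dvd_iff dvd_rfl).mpr ?_⟩
  rcases hdeg with h | h | h <;> simp [h]

/-- The digits `x0 * x3` and `x1 * x2` occur with equal coefficients in the line code. -/
lemma coeff_reduce_line_swap [CharP F 2] {t : ℕ} (ht : 0 < t) {c : MvPolynomial (Fin 4) F}
    (hc : c ∈ linePolys F (2 ^ t)) {d d' : Fin t → Fin 4 →₀ ℕ}
    (hd : ∀ i j, d i j ≤ 1) (hd2 : ∀ i, (d i).degree = 2)
    (hd' : ∀ i j, d' i j ≤ 1) (hd2' : ∀ i, (d' i).degree = 2)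
    (hdd : ∀ i, d i = d' i ∨ (d i = Finsupp.single 3 1 + Finsupp.single 0 1 ∧
      d' i = Finsupp.single 1 1 + Finsupp.single 2 1)) :
    coeff (ofDigitVec d) (reduce F (2 ^ t) c) = coeff (ofDigitVec d') (reduce F (2 ^ t) c) := by
  obtain ⟨l, a, b, hl, hab, rfl⟩ := hc
  have hpos : 0 < 2 ^ t - 1 := Nat.sub_pos_of_lt (Nat.one_lt_two_pow ht.ne')
  have key : ∀ d : Fin t → Fin 4 →₀ ℕ, (∀ i j, d i j ≤ 1) → (∀ i, (d i).degree = 2) →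
      coeff (ofDigitVec d) (reduce F (2 ^ t)
        ((1 + linForm F a ^ (2 ^ t - 1)) * (1 + linForm F b ^ (2 ^ t - 1)))) =
      ∏ i, coeff (d i) (linForm F a * linForm F b) ^ 2 ^ (i : ℕ) := by
    intro d hd hd2
    have hdeg := ofDigitVec_degree hd2
    rw [coeff_reduce_of_degree_le (ofDigitVec_apply_le hd), coeff_line_top hpos hdeg,
      coeff_ofDigitVec (linForm_mul_isHomogeneous a b) d hd hd2]
    intro m hm
    have := degree_of_coeff_line_ne_zero hm
    omega
  rw [key d hd hd2, key d' hd' hd2']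
  refine Finset.prod_congr rfl fun i _ => ?_
  rcases hdd i with h | ⟨h, h'⟩
  · rw [h]
  · rw [h, h', coeff_linForm_mul a b (by decide), coeff_linForm_mul a b (by decide),
      ← plucker_eq hl.2 hab, add_comm]

lemma exists_digits_of_coeff_reduce_line_ne_zero [CharP F 2] {t : ℕ} (ht : 0 < t)
    {c : MvPolynomial (Fin 4) F} (hc : c ∈ linePolys F (2 ^ t)) {e : Fin 4 →₀ ℕ}
    (hle : ∀ i, e i ≤ 2 ^ t - 1) (hdeg : e.degree = 2 * (2 ^ t - 1)) (he3 : e 3 = 2 ^ t - 1)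
    (he : coeff e (reduce F (2 ^ t) c) ≠ 0) :
    ∃ g : Fin t → Fin 4, (∀ i, g i ≠ 3) ∧
      e = ofDigitVec fun i => Finsupp.single 3 1 + Finsupp.single (g i) 1 := by
  obtain ⟨l, a, b, -, -, rfl⟩ := hc
  have hpos : 0 < 2 ^ t - 1 := Nat.sub_pos_of_lt (Nat.one_lt_two_pow ht.ne')
  rw [coeff_reduce_of_degree_le hle, coeff_line_top hpos hdeg] at he
  · exact exists_digits_of_coeff_ne_zero (linForm_mul_isHomogeneous a b) he3 he
  · intro m hm
    have := degree_of_coeff_line_ne_zero hm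
    omega

end Code

theorem h_in_span_of_x1_x2_monomials (t : ℕ) (ht : 0 < t) (q : ℕ) (hq : q = 2 ^ t)
    (hcard : Fintype.card k = q)
    (h : MvPolynomial (Fin 4) k)
    (hvars : (3 : Fin 4) ∉ h.vars)
    (hdeg : ∀ i : Fin 4, h.degreeOf i ≤ q - 1)
    (hmem : Ideal.Quotient.mk (II k q) ((1 + X 3 ^ (q - 1)) * h) ∈
      span k (Ideal.Quotient.mk (II k q) '' linePolys k q)) :
    h ∈ span k ({1} ∪
      {m : MvPolynomial (Fin 4) k | ∃ g : Fin t → Fin 4,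
        (∀ i, g i ∈ ({1, 2} : Set (Fin 4))) ∧
        m = ∏ i : Fin t, X (g i) ^ 2 ^ (i : ℕ)}) := by
  subst hq
  have : CharP k 2 := charP_of_card_eq_prime_pow hcard
  have hq2 : 2 ≤ 2 ^ t := Nat.one_lt_two_pow ht.ne'
  set n := 2 ^ t - 1 with hn
  set f := (1 + X 3 ^ n) * h with hf
  have hcoeff (m : Fin 4 →₀ ℕ) : coeff m f = coeff m h +
      if Finsupp.single 3 n ≤ m then coeff (m - Finsupp.single 3 n) h else 0 := by
    rw [hf, add_mul, one_mul, coeff_add, X_pow_eq_monomial, coeff_monomial_mul']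
    simp
  have hzero {m : Fin 4 →₀ ℕ} (hm : coeff m h ≠ 0) : m 3 = 0 := by
    by_contra hne
    exact hvars ((mem_vars_iff_mem_support 3).mpr
      ⟨m, mem_support_iff.mpr hm, Finsupp.mem_support_iff.mpr hne⟩)
  have hle {m : Fin 4 →₀ ℕ} (hm : coeff m h ≠ 0) (i : Fin 4) : m i ≤ n :=
    (degreeOf_le_iff.mp (hdeg i)) m (mem_support_iff.mpr hm)
  have hshift {m : Fin 4 →₀ ℕ} (hm : coeff m h ≠ 0) :
      coeff (m + Finsupp.single 3 n) f = coeff m h := by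
    rw [hcoeff, if_pos le_add_self, add_tsub_cancel_right, add_eq_right]
    by_contra hne
    have := hzero hne
    simp at this
    omega
  have hred : reduce k (2 ^ t) f = f := by
    refine reduce_eq_self fun m hm i => ?_
    rw [hcoeff] at hm
    by_cases hmh : coeff m h = 0
    · rw [hmh, zero_add, ite_ne_right_iff] at hm
      have h3 := hzero hm.2
      have hi := hle hm.2 i
      rcases eq_or_ne i 3 with rfl | hi3
      · simp at h3
        omega
      · simpa [Finsupp.single_eq_of_ne hi3] using hi
    · exact hle hmh i
  have hdegree {m : Fin 4 →₀ ℕ} (hm : coeff m h ≠ 0) (hm0 : m ≠ 0) : m.degree = n := by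
    obtain ⟨h1, h2⟩ := degree_of_coeff_ne_zero hq2 hmem (e := m + Finsupp.single 3 n)
      (by rwa [hred, hshift hm])
    rw [map_add, Finsupp.degree_single] at h1 h2
    have hpos : 0 < m.degree :=
      Nat.pos_of_ne_zero fun h0 => hm0 ((Finsupp.degree_eq_zero_iff m).mp h0)
    have := Nat.le_of_dvd hpos ((Nat.dvd_add_left dvd_rfl).mp h2)
    omega
  rw [h.as_sum]
  refine Submodule.sum_mem _ fun m hm => ?_
  rw [MvPolynomial.mem_support_iff] at hm
  rw [← mul_one (coeff m h), ← smul_eq_mul, ← smul_monomial]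
  refine Submodule.smul_mem _ _ (subset_span ?_)
  rcases eq_or_ne m 0 with rfl | hm0
  · exact Or.inl rfl
  have he3 : (m + Finsupp.single 3 n : Fin 4 →₀ ℕ) 3 = n := by simp [hzero hm]
  have hele (i : Fin 4) : (m + Finsupp.single 3 n : Fin 4 →₀ ℕ) i ≤ n := by
    rcases eq_or_ne i 3 with rfl | hi
    · exact he3.le
    · simpa [Finsupp.single_eq_of_ne hi] using hle hm i
  have hedeg : (m + Finsupp.single 3 n).degree = 2 * n := by
    rw [map_add, Finsupp.degree_single, hdegree hm hm0, two_mul]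
  obtain ⟨g, hg3, hg⟩ : ∃ g : Fin t → Fin 4, (∀ i, g i ≠ 3) ∧ m + Finsupp.single 3 n =
      ofDigitVec fun i => Finsupp.single 3 1 + Finsupp.single (g i) 1 := by
    by_contra hcon
    have h0 := functional_eq_zero_of_mem_span hq2 hmem (lcoeff k (m + Finsupp.single 3 n))
      fun c hc => by
        by_contra hne
        exact hcon (exists_digits_of_coeff_reduce_line_ne_zero ht hc hele hedeg he3 hne)
    rw [hred] at h0
    exact hm ((hshift hm).symm.trans h0)
  have hm_eq : m = ofDigitVec fun i => Finsupp.single (g i) 1 := by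
    rw [ofDigitVec_const_add, Finsupp.smul_single, smul_eq_mul, mul_one, add_comm] at hg
    exact add_left_cancel hg
  refine Or.inr ⟨g, fun i => ?_, by rw [hm_eq, monomial_ofDigitVec_single]⟩
  have hg0 : g i ≠ 0 := by
    intro hi
    set d : Fin t → Fin 4 →₀ ℕ := fun i => Finsupp.single 3 1 + Finsupp.single (g i) 1 with hd
    set d' : Fin t → Fin 4 →₀ ℕ := fun i =>
      if g i = 0 then Finsupp.single 1 1 + Finsupp.single 2 1 else d i with hd'
    have hpair {a b : Fin 4} (hab : a ≠ b) (j : Fin 4) :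
        (Finsupp.single a 1 + Finsupp.single b 1 : Fin 4 →₀ ℕ) j ≤ 1 := by
      simp only [Finsupp.add_apply, Finsupp.single_apply]
      split_ifs with h1 h2
      · exact absurd (h1.trans h2.symm) hab
      all_goals simp
    have hd1 (i) (j) : d i j ≤ 1 := hpair (hg3 i).symm j
    have hd2 (i) : (d i).degree = 2 := by simp [hd]
    have hd1' (i) (j) : d' i j ≤ 1 := by
      simp only [hd']
      split_ifs
      · exact hpair (by decide) j
      · exact hd1 i j
    have hd2' (i) : (d' i).degree = 2 := by
      simp only [hd']
      split_ifs
      · simp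
      · exact hd2 i
    have hswap := functional_eq_zero_of_mem_span hq2 hmem
      (lcoeff k (ofDigitVec d) - lcoeff k (ofDigitVec d')) fun c hc => by
        refine sub_eq_zero.mpr (coeff_reduce_line_swap ht hc hd1 hd2 hd1' hd2' fun i => ?_)
        by_cases h0 : g i = 0
        · exact Or.inr ⟨by simp [hd, h0], by simp [hd', h0]⟩
        · exact Or.inl (by simp [hd', h0])
    rw [hred, ← hg] at hswap
    have hlt : ofDigitVec d' 3 < n := ofDigitVec_apply_lt hd1' (i := i) (by simp [hd', hi])
    have hnle : ¬ Finsupp.single 3 n ≤ ofDigitVec d' := by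
      rw [Finsupp.single_le_iff]
      omega
    have hd'f : coeff (ofDigitVec d') f = 0 := by
      rw [hcoeff, if_neg hnle, add_zero]
      by_contra hne
      have hdeg' := ofDigitVec_degree hd2'
      have h0 : ofDigitVec d' ≠ 0 := by
        intro h0
        rw [h0, map_zero] at hdeg'
        omega
      have := hdegree hne h0
      omega
    exact hm ((hshift hm).symm.trans ((sub_eq_zero.mp hswap).trans hd'f))
  have := hg3 i
  simp only [Set.mem_insert_iff, Set.mem_singleton_iff]
  omega
end
end

section
/- Let q = 2^t for a positive integer t. The F_2-subspace {c ∈ C(P,L1) : c(p) = 0 for every point p ∈ P1} (that is, ker π ∩ C(P,L1)) has dimension exactly q - 1; moreover, fixing an arbitrary line ℓ ≠ ℓ0 through p0, the q - 1 functions χ_ℓ + χ_{ℓ'}, where ℓ' ranges over the lines through p0 different from ℓ0 and ℓ, form a basis of this subspace. -/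
open Submodule Module
open scoped Classical

noncomputable section

variable (k : Type) [Field k] [Fintype k]

/-- Points of the projective space: 1-dimensional subspaces of `k^4`. -/
def IsPt (p : Submodule k (Fin 4 → k)) : Prop := finrank k p = 1

/-- The point set `P`. -/
abbrev Pt := {p : Submodule k (Fin 4 → k) // IsPt k p}

def e (i : Fin 4) : Fin 4 → k := Pi.single i 1

/-- The fixed point `p0 = span{e0}`. -/
def p0 : Submodule k (Fin 4 → k) := span k {e k 0}

/-- The fixed line `ℓ0 = span{e0, e1}`. -/
def l0 : Submodule k (Fin 4 → k) := span k {e k 0, e k 1}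

/-- Membership in `P1`: points `span{v}` with `B(e0, v) ≠ 0`. -/
def InP1 (p : Pt k) : Prop := ∃ v ∈ (p : Submodule k (Fin 4 → k)), B k (e k 0) v ≠ 0

/-- The characteristic function of a line, as an `F_2`-valued function on `P`. -/
def chi (l : Submodule k (Fin 4 → k)) : Pt k → ZMod 2 :=
  fun p => if (p : Submodule k (Fin 4 → k)) ≤ l then 1 else 0

/-- The set `L1` of lines meeting `ℓ0` only in `0`. -/
def L1 : Set (Submodule k (Fin 4 → k)) := {l | IsLn k l ∧ l ⊓ l0 k = ⊥}

/-- The code `C(P,L)`. -/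
def CPL : Submodule (ZMod 2) (Pt k → ZMod 2) := span (ZMod 2) (chi k '' {l | IsLn k l})

/-- The code `C(P,L1)`. -/
def CPL1 : Submodule (ZMod 2) (Pt k → ZMod 2) := span (ZMod 2) (chi k '' L1 k)

/-- Restriction of functions on `P` to `P1`. -/
def piP1 : (Pt k → ZMod 2) →ₗ[ZMod 2] ({p : Pt k // InP1 k p} → ZMod 2) :=
  LinearMap.funLeft (ZMod 2) (ZMod 2) Subtype.val

/-- The code `C(P1,L1)`, the image of `C(P,L1)` under restriction to `P1`. -/
def CP1L1 : Submodule (ZMod 2) ({p : Pt k // InP1 k p} → ZMod 2) := (CPL1 k).map (piP1 k)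

/-- `X0`: the characteristic functions of the lines through `p0`, except `χ_{ℓ0}`. -/
def X0 : Set (Pt k → ZMod 2) :=
  (chi k '' {l | IsLn k l ∧ p0 k ≤ l}) \ {chi k (l0 k)}


variable {k}

section

omit [Fintype k]

lemma mem_l0_iff (v : Fin 4 → k) : v ∈ l0 k ↔ v 2 = 0 ∧ v 3 = 0 := by
  rw [l0, mem_span_pair]
  constructor
  · rintro ⟨a, b, rfl⟩
    simp [e]
  · rintro ⟨h2, h3⟩
    refine ⟨v 0, v 1, ?_⟩
    ext i
    fin_cases i <;> simp [e, h2, h3]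

/-- A subspace spanned by two orthogonal independent vectors is a line. -/
lemma isLn_span_pair {u w : Fin 4 → k} (h : B k u w = 0) (hi : LinearIndependent k ![u, w]) :
    IsLn k (span k {u, w}) := by
  constructor
  · have hr : Set.range ![u, w] = {u, w} := by simp [Matrix.range_cons, Set.pair_comm]
    rw [← hr, finrank_span_eq_card hi, Fintype.card_fin]
  · intro x hx y hy
    obtain ⟨a, b, rfl⟩ := mem_span_pair.1 hx
    obtain ⟨c, d, rfl⟩ := mem_span_pair.1 hy
    simp only [B, Pi.add_apply, Pi.smul_apply, smul_eq_mul] at h ⊢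
    linear_combination (a * d - b * c) * h

lemma IsLn.eq_of_le {l m : Submodule k (Fin 4 → k)} (hl : IsLn k l) (hm : IsLn k m) (h : l ≤ m) :
    l = m :=
  eq_of_le_of_finrank_eq h (hl.1.trans hm.1.symm)

lemma isLn_l0 : IsLn k (l0 k) := by
  refine isLn_span_pair (by simp [B, e]) (LinearIndependent.pair_iff.2 fun x y h => ?_)
  have h0 := congrFun h 0
  have h1 := congrFun h 1
  simp_all [e]

/-- The line through `p0` and `(0, a, 1, 0)`. -/
def pencilLine (a : k) : Submodule k (Fin 4 → k) := span k {![1, 0, 0, 0], ![0, a, 1, 0]}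

lemma mem_pencilLine (a : k) (v : Fin 4 → k) :
    v ∈ pencilLine a ↔ v 3 = 0 ∧ v 1 = a * v 2 := by
  rw [pencilLine, mem_span_pair]
  constructor
  · rintro ⟨x, y, rfl⟩
    simp [mul_comm]
  · rintro ⟨h3, h1⟩
    refine ⟨v 0, v 2, ?_⟩
    ext i
    fin_cases i <;> simp [h3, h1, mul_comm]

lemma isLn_pencilLine (a : k) : IsLn k (pencilLine a) := by
  refine isLn_span_pair (by simp [B]) (LinearIndependent.pair_iff.2 fun x y h => ?_)
  have h0 := congrFun h 0
  have h2 := congrFun h 2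
  simp_all

lemma p0_le_iff (l : Submodule k (Fin 4 → k)) : p0 k ≤ l ↔ e k 0 ∈ l := by
  simp [p0]

lemma p0_le_pencilLine (a : k) : p0 k ≤ pencilLine a := by
  rw [p0_le_iff, mem_pencilLine]
  simp [e]

lemma pencilLine_ne_l0 (a : k) : pencilLine a ≠ l0 k := by
  intro h
  have : ![0, a, 1, 0] ∈ pencilLine a := by simp [mem_pencilLine]
  rw [h, mem_l0_iff] at this
  simp at this

lemma pencilLine_injective : Function.Injective (pencilLine (k := k)) := by
  intro a b h
  have : ![0, a, 1, 0] ∈ pencilLine a := by simp [mem_pencilLine]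
  rw [h, mem_pencilLine] at this
  simpa using this

lemma eq_pencilLine {l : Submodule k (Fin 4 → k)} (hl : IsLn k l) (hp : p0 k ≤ l)
    (hne : l ≠ l0 k) : ∃ a, l = pencilLine a := by
  rw [p0_le_iff] at hp
  have h3 : ∀ v ∈ l, v 3 = 0 := fun v hv => by
    simpa [B, e] using hl.2 _ hp v hv
  obtain ⟨v, hv, hv0⟩ : ∃ v ∈ l, v ∉ l0 k := by
    by_contra! h
    exact hne (hl.eq_of_le isLn_l0 h)
  have hv2 : v 2 ≠ 0 := fun h => hv0 ((mem_l0_iff v).2 ⟨h, h3 v hv⟩)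
  refine ⟨v 1 / v 2, ((isLn_pencilLine _).eq_of_le hl fun w hw => ?_).symm⟩
  rw [mem_pencilLine] at hw
  have : w = (w 0 - w 2 / v 2 * v 0) • e k 0 + (w 2 / v 2) • v := by
    ext i
    fin_cases i <;> simp [e, hw, h3 v hv, hv2]
    field_simp
  rw [this]
  exact l.add_mem (l.smul_mem _ hp) (l.smul_mem _ hv)

/-- The line disjoint from `l0` spanned by `(p, m, 1, 0)` and `(s, p, 0, 1)`. -/
def affLine (p m s : k) : Submodule k (Fin 4 → k) := span k {![p, m, 1, 0], ![s, p, 0, 1]}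

lemma mem_affLine (p m s : k) (v : Fin 4 → k) :
    v ∈ affLine p m s ↔ v 0 = v 2 * p + v 3 * s ∧ v 1 = v 2 * m + v 3 * p := by
  rw [affLine, mem_span_pair]
  constructor
  · rintro ⟨x, y, rfl⟩
    simp
  · rintro ⟨h0, h1⟩
    refine ⟨v 2, v 3, ?_⟩
    ext i
    fin_cases i <;> simp [h0, h1]

lemma affLine_mem_L1 (p m s : k) : affLine p m s ∈ L1 k := by
  refine ⟨isLn_span_pair (by simp [B]) (LinearIndependent.pair_iff.2 fun x y h => ?_), ?_⟩
  · have h2 := congrFun h 2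
    have h3 := congrFun h 3
    simp_all
  · refine (Submodule.eq_bot_iff _).2 fun v hv => ?_
    have h1 := (mem_affLine p m s v).1 hv.1
    have h2 := (mem_l0_iff v).1 hv.2
    ext i
    fin_cases i <;> simp [h1, h2]

lemma eq_affLine {l : Submodule k (Fin 4 → k)} (hl : l ∈ L1 k) : ∃ p m s, l = affLine p m s := by
  obtain ⟨hl, hd⟩ := hl
  let f : l →ₗ[k] k × k := ((LinearMap.proj 2).prod (LinearMap.proj 3)).comp l.subtype
  have hf : Function.Injective f := by
    rw [injective_iff_map_eq_zero]
    intro v hv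
    have : (v : Fin 4 → k) ∈ l ⊓ l0 k := ⟨v.2, (mem_l0_iff _).2 (by simpa [f] using hv)⟩
    rw [hd] at this
    simpa using this
  have hs : Function.Surjective f :=
    (LinearMap.injective_iff_surjective_of_finrank_eq_finrank (by simp [hl.1])).1 hf
  obtain ⟨⟨u, hu⟩, hu'⟩ := hs (1, 0)
  obtain ⟨⟨w, hw⟩, hw'⟩ := hs (0, 1)
  replace hu' : u 2 = 1 ∧ u 3 = 0 := Prod.mk.inj hu'
  replace hw' : w 2 = 0 ∧ w 3 = 1 := Prod.mk.inj hw'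
  have hb : u 0 = w 1 := by
    have := hl.2 u hu w hw
    simp only [B, hu'.1, hu'.2, hw'.1, hw'.2] at this
    linear_combination this
  refine ⟨u 0, u 1, w 0, ((affLine_mem_L1 _ _ _).1.eq_of_le hl ?_).symm⟩
  have hu1 : ![u 0, u 1, 1, 0] = u := by ext i; fin_cases i <;> simp [hu']
  have hw1 : ![w 0, u 0, 0, 1] = w := by ext i; fin_cases i <;> simp [hw', hb]
  rw [affLine, hu1, hw1, span_le]
  rintro x (rfl | rfl) <;> assumption

/-- The value of `c` at the point spanned by `v`, and `0` for `v = 0`, as a linear functional. -/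
def evalAt (v : Fin 4 → k) : (Pt k → ZMod 2) →ₗ[ZMod 2] ZMod 2 :=
  if h : v ≠ 0 then LinearMap.proj ⟨span k {v}, finrank_span_singleton h⟩ else 0

lemma evalAt_chi {v : Fin 4 → k} (hv : v ≠ 0) (l : Submodule k (Fin 4 → k)) :
    evalAt v (chi k l) = if v ∈ l then 1 else 0 := by
  simp [evalAt, hv, chi]

lemma evalAt_chi_pencilLine (a b : k) :
    evalAt ![0, b, 1, 0] (chi k (pencilLine a)) = if b = a then 1 else 0 := by
  have hv : (![0, b, 1, 0] : Fin 4 → k) ≠ 0 := fun h => by simpa using congrFun h 2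
  simp [evalAt_chi hv, mem_pencilLine]

lemma ext_evalAt {c d : Pt k → ZMod 2} (h : ∀ v, v ≠ 0 → evalAt v c = evalAt v d) : c = d := by
  funext ⟨p, hp⟩
  obtain ⟨v, hv, rfl⟩ : ∃ v, v ≠ 0 ∧ p = span k {v} := by
    obtain ⟨v, hv0, hv⟩ := finrank_eq_one_iff'.1 hp
    refine ⟨v, by simpa using hv0, le_antisymm (fun w hw => ?_) (by simp)⟩
    obtain ⟨a, ha⟩ := hv ⟨w, hw⟩
    exact mem_span_singleton.2 ⟨a, congrArg Subtype.val ha⟩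
  simpa [evalAt, hv] using h v hv

lemma evalAt_smul {a : k} (ha : a ≠ 0) (v : Fin 4 → k) : evalAt (a • v) = evalAt v := by
  by_cases hv : v = 0
  · simp [hv]
  · have : span k {a • v} = span k {v} := span_singleton_smul_eq (IsUnit.mk0 a ha) v
    simp [evalAt, hv, ha, this]

lemma mem_ker_piP1 (c : Pt k → ZMod 2) :
    c ∈ LinearMap.ker (piP1 k) ↔ ∀ v, v 3 ≠ 0 → evalAt v c = 0 := by
  rw [LinearMap.mem_ker]
  constructor
  · intro h v hv
    have hv0 : v ≠ 0 := by rintro rfl; simp at hv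
    have := congrFun h ⟨⟨span k {v}, finrank_span_singleton hv0⟩, v,
      mem_span_singleton_self v, by simpa [B, e] using hv⟩
    simpa [evalAt, hv0, piP1, LinearMap.funLeft] using this
  · intro h
    funext ⟨⟨p, hp⟩, v, hv, hB⟩
    have hv3 : v 3 ≠ 0 := by simpa [B, e] using hB
    have hv0 : v ≠ 0 := by rintro rfl; simp at hv3
    have hpv : span k {v} = p :=
      eq_of_le_of_finrank_eq (by simpa using hv) ((finrank_span_singleton hv0).trans hp.symm)
    subst hpv
    simpa [evalAt, hv0, piP1, LinearMap.funLeft] using h v hv3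

/-- A functional vanishing on the lines `affLine p m s` vanishes on `CPL1`. -/
lemma eq_zero_of_mem_CPL1 {c : Pt k → ZMod 2} (hc : c ∈ CPL1 k)
    (f : (Pt k → ZMod 2) →ₗ[ZMod 2] ZMod 2) (hf : ∀ p m s, f (chi k (affLine p m s)) = 0) :
    f c = 0 := by
  have : CPL1 k ≤ LinearMap.ker f := by
    rw [CPL1, span_le]
    rintro _ ⟨l, hl, rfl⟩
    obtain ⟨p, m, s, rfl⟩ := eq_affLine hl
    exact hf p m s
  exact this hc

lemma evalAt_eq_zero_of_mem_CPL1 {c : Pt k → ZMod 2} (hc : c ∈ CPL1 k) {v : Fin 4 → k}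
    (h2 : v 2 = 0) (h3 : v 3 = 0) : evalAt v c = 0 := by
  by_cases hv : v = 0
  · simp [evalAt, hv]
  refine eq_zero_of_mem_CPL1 hc _ fun p m s => ?_
  rw [evalAt_chi hv, if_neg]
  rw [mem_affLine]
  rintro ⟨h0, h1⟩
  refine hv ?_
  ext i
  fin_cases i <;> simp [h0, h1, h2, h3]

end

/-- The points of the hyperbolic line spanned by `(r, a, 1, 0)` and `(0, r', 0, 1)`, as a
functional. -/
def hypSum (a r r' : k) : (Pt k → ZMod 2) →ₗ[ZMod 2] ZMod 2 :=
  ∑ b, evalAt ![r, a + b * r', 1, b] + evalAt ![0, r', 0, 1]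

lemma hypSum_chi_affLine (a r r' p m s : k) (hr : r ≠ r') :
    hypSum a r r' (chi k (affLine p m s)) =
      if s = 0 then (if r = p ∨ r' = p then 1 else 0)
      else if (a - m) * s + (r - p) * (r' - p) = 0 then 1 else 0 := by
  have h1 : ∀ b, (![r, a + b * r', 1, b] : Fin 4 → k) ≠ 0 := fun b h => by
    simpa using congrFun h 2
  have h2 : (![0, r', 0, 1] : Fin 4 → k) ≠ 0 := fun h => by simpa using congrFun h 3
  simp only [hypSum, LinearMap.add_apply, LinearMap.sum_apply, evalAt_chi (h1 _),
    evalAt_chi h2, mem_affLine]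
  simp only [Matrix.cons_val, one_mul, zero_mul, zero_add]
  by_cases hs : s = 0
  · subst hs
    by_cases hp : r = p
    · subst hp
      have : ∀ b, (a + b * r' = m + b * r) ↔ b = (m - a) / (r' - r) := fun b => by
        rw [eq_div_iff (sub_ne_zero.2 hr.symm)]
        constructor <;> intro h <;> linear_combination h
      simp [this, hr.symm]
    · simp [hp]
  · have : ∀ b, (r = p + b * s ∧ a + b * r' = m + b * p) ↔
        (b = (r - p) / s ∧ (a - m) * s + (r - p) * (r' - p) = 0) := fun b => by
      rw [eq_div_iff hs]
      constructor
      · rintro ⟨h, h'⟩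
        refine ⟨by linear_combination -h, by linear_combination s * h' + (r' - p) * h⟩
      · rintro ⟨h, h'⟩
        refine ⟨by linear_combination -h, mul_right_cancel₀ hs ?_⟩
        linear_combination h' + (r' - p) * h
    have hs' : (0 : k) ≠ s := Ne.symm hs
    simp only [this, hs, hs', false_and, if_false, add_zero, ite_and]
    simp

lemma evalAt_eq_of_mem_CPL1 {c : Pt k → ZMod 2} (hc : c ∈ CPL1 k)
    (hk : c ∈ LinearMap.ker (piP1 k)) (a r r' : k) :
    evalAt ![r, a, 1, 0] c = evalAt ![r', a, 1, 0] c := by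
  rcases eq_or_ne r r' with rfl | hr
  · rfl
  rw [mem_ker_piP1] at hk
  have key : ∀ x y : k, hypSum a x y c = evalAt ![x, a, 1, 0] c := fun x y => by
    simp only [hypSum, LinearMap.add_apply, LinearMap.sum_apply]
    rw [hk ![0, y, 0, 1] (by simp), add_zero, Finset.sum_eq_single 0]
    · simp
    · exact fun b _ hb => hk _ (by simpa using hb)
    · simp
  rw [← key r r', ← key r' r, ← sub_eq_zero, ← LinearMap.sub_apply]
  refine eq_zero_of_mem_CPL1 hc _ fun p m s => ?_
  rw [LinearMap.sub_apply, hypSum_chi_affLine _ _ _ _ _ _ hr, hypSum_chi_affLine _ _ _ _ _ _ hr.symm,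
    sub_eq_zero, mul_comm (r - p)]
  simp only [or_comm]

/-- Over a field of even order, the values of `c` on the points `(0, a, 1, 0)` sum to zero. -/
lemma sum_evalAt_eq_zero (h2 : (Fintype.card k : ZMod 2) = 0) {c : Pt k → ZMod 2}
    (hc : c ∈ CPL1 k) (hk : c ∈ LinearMap.ker (piP1 k)) :
    ∑ a : k, evalAt ![0, a, 1, 0] c = 0 := by
  let f : (Pt k → ZMod 2) →ₗ[ZMod 2] ZMod 2 :=
    ∑ a : k, ∑ r : k, evalAt ![r, a, 1, 0] + ∑ a : k, evalAt ![0, a, 1, 0] +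
      ∑ n : k, ∑ m : k, evalAt ![0, m, n, 1]
  have hf : f c = ∑ a : k, evalAt ![0, a, 1, 0] c := by
    simp only [f, LinearMap.add_apply, LinearMap.sum_apply]
    rw [Finset.sum_congr rfl fun a _ => Finset.sum_congr rfl fun r _ =>
        evalAt_eq_of_mem_CPL1 hc hk a r 0,
      Finset.sum_eq_zero fun n _ => Finset.sum_eq_zero fun m _ =>
        (mem_ker_piP1 c).1 hk ![0, m, n, 1] (by simp)]
    simp [h2]
  rw [← hf]
  refine eq_zero_of_mem_CPL1 hc f fun p m s => ?_
  have n1 : ∀ r a, (![r, a, 1, 0] : Fin 4 → k) ≠ 0 := fun r a h => by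
    simpa using congrFun h 2
  have n2 : ∀ m n, (![0, m, n, 1] : Fin 4 → k) ≠ 0 := fun m n h => by
    simpa using congrFun h 3
  simp only [f, LinearMap.add_apply, LinearMap.sum_apply, evalAt_chi (n1 _ _),
    evalAt_chi (n2 _ _), mem_affLine]
  simp only [Matrix.cons_val, one_mul, zero_mul, add_zero, ite_and]
  by_cases hp : p = 0
  · subst hp
    by_cases hs : s = 0
    · simp [hs, h2]
      decide
    · simp [Ne.symm hs]
      decide
  · have : ∀ n, (0 = n * p + s) ↔ n = -s / p := fun n => by
      rw [eq_div_iff hp]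
      constructor <;> intro h <;> linear_combination -h
    simp [this, Ne.symm hp]
    decide

/-- The members, other than `pencilLine a`, of one ruling of the quadric
`(a + b) x₀ x₃ = (x₁ + a x₂) (x₁ + b x₂)`. -/
def rulingLine (a b s : k) : Submodule k (Fin 4 → k) :=
  affLine (s * (a + b)) b ((a + b) * s ^ 2)

lemma evalAt_sum_ruling (h2 : (2 : k) = 0) {a b : k} (hab : a ≠ b) {v : Fin 4 → k} (hv : v ≠ 0) :
    evalAt v (∑ s, chi k (rulingLine a b s) + chi k (pencilLine a)) =
      if (a + b) * v 0 * v 3 = (v 1 + a * v 2) * (v 1 + b * v 2) then 1 else 0 := by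
  have hc : a + b ≠ 0 := fun h => hab (by linear_combination h - b * h2)
  have hmem : ∀ s, v ∈ rulingLine a b s ↔
      v 0 = s * (v 1 + a * v 2) ∧ v 1 + b * v 2 = (a + b) * s * v 3 := fun s => by
    rw [rulingLine, mem_affLine]
    constructor
    · rintro ⟨h0, h1⟩
      constructor
      · linear_combination h0 - s * h1
      · linear_combination h1 + v 2 * b * h2
    · rintro ⟨h0, h1⟩
      constructor
      · linear_combination h0 + s * h1 - s * b * v 2 * h2
      · linear_combination h1 - v 2 * b * h2
  simp only [map_add, map_sum, evalAt_chi hv, hmem, mem_pencilLine]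
  have hM : v 1 = a * v 2 ↔ v 1 + a * v 2 = 0 :=
    ⟨fun h => by linear_combination h + a * v 2 * h2, fun h => by linear_combination h - a * v 2 * h2⟩
  rw [hM]
  by_cases hM0 : v 1 + a * v 2 = 0
  · by_cases h3 : v 3 = 0
    · have hne : ¬ (v 0 = 0 ∧ v 1 + b * v 2 = 0) := by
        rintro ⟨h0, hN⟩
        have hv2 : v 2 = 0 := by
          refine (mul_eq_zero.1 ?_).resolve_left (sub_ne_zero.2 hab)
          linear_combination hM0 - hN
        refine hv ?_
        ext i
        fin_cases i <;> simp_all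
      simp [hM0, h3, hne]
    · have : ∀ s, v 1 + b * v 2 = (a + b) * s * v 3 ↔ s = (v 1 + b * v 2) / ((a + b) * v 3) :=
        fun s => by
          rw [eq_div_iff (mul_ne_zero hc h3)]
          constructor <;> intro h <;> linear_combination -h
      simp [hM0, h3, this, ite_and, hc]
  · have : ∀ s, (v 0 = s * (v 1 + a * v 2) ∧ v 1 + b * v 2 = (a + b) * s * v 3) ↔
        s = v 0 / (v 1 + a * v 2) ∧ (a + b) * v 0 * v 3 = (v 1 + a * v 2) * (v 1 + b * v 2) :=
      fun s => by
        rw [eq_div_iff hM0]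
        constructor
        · rintro ⟨h0, h1⟩
          exact ⟨h0.symm, by linear_combination (a + b) * v 3 * h0 - (v 1 + a * v 2) * h1⟩
        · rintro ⟨h0, h1⟩
          refine ⟨h0.symm, mul_left_cancel₀ hM0 ?_⟩
          linear_combination -h1 - (a + b) * v 3 * h0
    simp [hM0, this, ite_and]

lemma chi_pencilLine_add_mem (h2 : (2 : k) = 0) {a b : k} (hab : a ≠ b) :
    chi k (pencilLine a) + chi k (pencilLine b) ∈ CPL1 k ⊓ LinearMap.ker (piP1 k) := by
  constructor
  · have hsum : chi k (pencilLine a) + chi k (pencilLine b) =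
        ∑ s, chi k (rulingLine a b s) + ∑ s, chi k (rulingLine b a s) := by
      refine ext_evalAt fun v hv => ?_
      have ha := evalAt_sum_ruling h2 hab hv
      have hb := evalAt_sum_ruling h2 hab.symm hv
      rw [add_comm b a, mul_comm (v 1 + b * v 2), ← ha] at hb
      simp only [map_add] at hb ⊢
      rw [← CharTwo.add_eq_zero] at hb ⊢
      rw [← hb]
      ring
    have hmem : ∀ p m s : k, chi k (affLine p m s) ∈ CPL1 k := fun p m s =>
      subset_span (Set.mem_image_of_mem _ (affLine_mem_L1 p m s))
    rw [hsum]
    exact add_mem (sum_mem fun s _ => hmem _ _ _) (sum_mem fun s _ => hmem _ _ _)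
  · refine (mem_ker_piP1 _).2 fun v hv => ?_
    have hv0 : v ≠ 0 := by rintro rfl; simp at hv
    simp [evalAt_chi hv0, mem_pencilLine, hv]

lemma linearIndependent_chi_pencilLine_add (a : k) :
    LinearIndependent (ZMod 2)
      (fun b : {b // b ≠ a} => chi k (pencilLine a) + chi k (pencilLine (b : k))) := by
  rw [Fintype.linearIndependent_iff]
  intro g hg b
  have h := congrArg (evalAt ![0, (b : k), 1, 0]) hg
  simpa [evalAt_chi_pencilLine, b.2, Subtype.coe_inj] using h

lemma eq_sum_chi_pencilLine (h2 : (Fintype.card k : ZMod 2) = 0) {c : Pt k → ZMod 2}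
    (hc : c ∈ CPL1 k) (hk : c ∈ LinearMap.ker (piP1 k)) :
    c = ∑ a : k, evalAt ![0, a, 1, 0] c • chi k (pencilLine a) := by
  refine ext_evalAt fun v hv => ?_
  simp only [map_sum, map_smul, evalAt_chi hv, mem_pencilLine, smul_eq_mul]
  by_cases h3 : v 3 = 0
  · by_cases hv2 : v 2 = 0
    · rw [evalAt_eq_zero_of_mem_CPL1 hc hv2 h3]
      simp [h3, hv2, sum_evalAt_eq_zero h2 hc hk]
    · have hv' : v = v 2 • ![v 0 / v 2, v 1 / v 2, 1, 0] := by
        ext i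
        fin_cases i <;> simp [h3] <;> field_simp
      have : ∀ a, v 1 = a * v 2 ↔ a = v 1 / v 2 := fun a => by rw [eq_div_iff hv2, eq_comm]
      simp only [h3, this]
      rw [hv', evalAt_smul hv2, evalAt_eq_of_mem_CPL1 hc hk _ _ 0]
      simp [hv2]
  · rw [(mem_ker_piP1 c).1 hk v h3]
    simp [h3]

lemma span_chi_pencilLine_add (h2 : (2 : k) = 0) (hcard : (Fintype.card k : ZMod 2) = 0) (a : k) :
    span (ZMod 2) (Set.range
      fun b : {b // b ≠ a} => chi k (pencilLine a) + chi k (pencilLine (b : k))) =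
      CPL1 k ⊓ LinearMap.ker (piP1 k) := by
  refine le_antisymm (span_le.2 ?_) fun c hc => ?_
  · rintro _ ⟨b, rfl⟩
    exact chi_pencilLine_add_mem h2 b.2.symm
  · have hsum : c = ∑ b : k, evalAt ![0, b, 1, 0] c •
        (chi k (pencilLine a) + chi k (pencilLine b)) := by
      simp only [smul_add, Finset.sum_add_distrib, ← Finset.sum_smul,
        sum_evalAt_eq_zero hcard hc.1 hc.2, zero_smul, zero_add]
      exact eq_sum_chi_pencilLine hcard hc.1 hc.2
    rw [hsum]
    refine sum_mem fun b _ => smul_mem _ _ ?_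
    by_cases hb : b = a
    · rw [hb, show chi k (pencilLine a) + chi k (pencilLine a) = 0 from
        funext fun p => CharTwo.add_self_eq_zero _]
      exact zero_mem _
    · exact subset_span ⟨⟨b, hb⟩, rfl⟩

variable (k)

theorem dim_ker_inter_CPL1 (t : ℕ) (ht : 0 < t) (q : ℕ) (hq : q = 2 ^ t)
    (hcard : Fintype.card k = q) :
    finrank (ZMod 2) ↥(CPL1 k ⊓ LinearMap.ker (piP1 k)) = q - 1 ∧
    ∀ l : Submodule k (Fin 4 → k), IsLn k l → p0 k ≤ l → l ≠ l0 k →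
      (LinearIndependent (ZMod 2)
        (fun f : {f : Pt k → ZMod 2 | ∃ l' : Submodule k (Fin 4 → k),
            IsLn k l' ∧ p0 k ≤ l' ∧ l' ≠ l0 k ∧ l' ≠ l ∧ f = chi k l + chi k l'} =>
          (f : Pt k → ZMod 2)) ∧
      span (ZMod 2) {f : Pt k → ZMod 2 | ∃ l' : Submodule k (Fin 4 → k),
          IsLn k l' ∧ p0 k ≤ l' ∧ l' ≠ l0 k ∧ l' ≠ l ∧ f = chi k l + chi k l'}
        = CPL1 k ⊓ LinearMap.ker (piP1 k)) := by
  have hcard2 : (Fintype.card k : ZMod 2) = 0 := by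
    rw [hcard, hq, Nat.cast_pow, show ((2 : ℕ) : ZMod 2) = 0 from rfl, zero_pow ht.ne']
  have h2 : (2 : k) = 0 := by
    have h := Nat.cast_card_eq_zero k
    rw [hcard, hq, Nat.cast_pow] at h
    exact_mod_cast pow_eq_zero_iff ht.ne' |>.1 h
  refine ⟨?_, fun l hl hp hne => ?_⟩
  · rw [← span_chi_pencilLine_add h2 hcard2 0,
      finrank_span_eq_card (linearIndependent_chi_pencilLine_add 0)]
    simp [Fintype.card_subtype_compl, hcard]
  · obtain ⟨a, rfl⟩ := eq_pencilLine hl hp hne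
    have hset : {f : Pt k → ZMod 2 | ∃ l' : Submodule k (Fin 4 → k),
        IsLn k l' ∧ p0 k ≤ l' ∧ l' ≠ l0 k ∧ l' ≠ pencilLine a ∧
          f = chi k (pencilLine a) + chi k l'} =
        Set.range fun b : {b // b ≠ a} =>
          chi k (pencilLine a) + chi k (pencilLine (b : k)) := by
      ext f
      constructor
      · rintro ⟨l', h1, h2, h3, h4, rfl⟩
        obtain ⟨b, rfl⟩ := eq_pencilLine h1 h2 h3
        exact ⟨⟨b, fun h => h4 (h ▸ rfl)⟩, rfl⟩
      · rintro ⟨b, rfl⟩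
        exact ⟨_, isLn_pencilLine _, p0_le_pencilLine _, pencilLine_ne_l0 _,
          fun h => b.2 (pencilLine_injective h), rfl⟩
    rw [hset]
    exact ⟨(linearIndependent_chi_pencilLine_add a).linearIndepOn_id,
      span_chi_pencilLine_add h2 hcard2 a⟩
end
end
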